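/- Let 𝒜, ℬ be open MDPs such that 𝒜⨟ℬ is well-defined, and let τ be a memoryless scheduler on 𝒜⨟ℬ with restrictions τ^𝒜 to the states of 𝒜 and τ^ℬ to the states of ℬ. Then for every entrance i of 𝒜 or ℬ and every exit j of 𝒜⨟ℬ: Pr^{𝒜⨟ℬ,τ}(i ⊨ ◇j) = Pr^{𝒜,τ^𝒜}(i ⊨ ◇j) + Σ_{k∈O_r^𝒜} Pr^{𝒜,τ^𝒜}(i ⊨ ◇k) · Pr^{𝒜⨟ℬ,τ}(Nx(k) ⊨ ◇j) if i is an entrance of 𝒜 (where Pr^{𝒜,τ^𝒜}(i ⊨ ◇j) := 0 when j is not an exit of 𝒜), and Pr^{𝒜⨟ℬ,τ}(i ⊨ ◇j) = Pr^{ℬ,τ^ℬ}(i ⊨ ◇j) + Σ_{k∈O_l^ℬ} Pr^{ℬ,τ^ℬ}(i ⊨ ◇k) · Pr^{𝒜⨟ℬ,τ}(Nx(k) ⊨ ◇j) if i is an entrance of ℬ, where Nx maps the i-th element of O_r^𝒜 to the i-th element of I_r^ℬ and the i-th element of O_l^ℬ to the i-th element of I_l^𝒜. -/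

import Mathlib

open scoped Classical ENNReal

namespace SD

/-- A Markov decision process with finite sets of states and actions: a partial
transition function assigning to a state and an action a probability
distribution over states. -/
structure MDP (S A : Type) : Type where
  P : S → A → Option (S → ℝ)

namespace MDP

variable {S A : Type} [Fintype S] [Fintype A]

/-- All defined transitions are genuine probability distributions. -/
def Proper (M : MDP S A) : Prop :=
  ∀ s a d, M.P s a = some d → (∀ s', 0 ≤ d s') ∧ ∑ s', d s' = 1

/-- The action `a` is enabled in `s`. -/
def enabled (M : MDP S A) (s : S) (a : A) : Prop := M.P s a ≠ none

/-- A state is terminal if no action is enabled in it. -/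
def terminal (M : MDP S A) (s : S) : Prop := ∀ a, M.P s a = none

/-- Transition probabilities. -/
noncomputable def prob (M : MDP S A) (s : S) (a : A) (s' : S) : ℝ :=
  (M.P s a).elim 0 fun d => d s'

end MDP

/-- A finite path of an MDP: a start state with a list of (action, next state) steps. -/
structure FinPath (S A : Type) : Type where
  start : S
  steps : List (A × S)

namespace FinPath

/-- The last state of a finite path. -/
def last {S A : Type} (π : FinPath S A) : S := (π.steps.map Prod.snd).getLastD π.start

/-- Extending a finite path by one step. -/
def snoc {S A : Type} (π : FinPath S A) (a : A) (s : S) : FinPath S A :=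
  ⟨π.start, π.steps ++ [(a, s)]⟩

end FinPath

namespace MDP

variable {S A : Type} [Fintype S] [Fintype A]

/-- Consistency of a sequence of steps with the transitions, from a given state. -/
def ConsistentFrom (M : MDP S A) : S → List (A × S) → Prop
  | _, [] => True
  | s, (a, s') :: l => M.prob s a s' ≠ 0 ∧ ConsistentFrom M s' l

/-- A finite path is consistent if every step has nonzero probability. -/
def Consistent (M : MDP S A) (π : FinPath S A) : Prop := M.ConsistentFrom π.start π.steps

end MDP

/-- A (history-dependent, stochastic) scheduler, given by its raw weights. -/
abbrev Sched (S A : Type) : Type := FinPath S A → A → ℝ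

namespace MDP

variable {S A : Type} [Fintype S] [Fintype A]

/-- `σ` is a scheduler for `M`: it assigns to every (consistent) finite path a
probability distribution over the actions enabled in its last state. -/
def IsSched (M : MDP S A) (σ : Sched S A) : Prop :=
  ∀ π : FinPath S A, M.Consistent π →
    (∀ a, 0 ≤ σ π a) ∧ (∀ a, σ π a ≠ 0 → M.enabled π.last a) ∧
      (¬M.terminal π.last → ∑ a, σ π a = 1)

end MDP

/-- Memoryless schedulers depend only on the last state of a path. -/
def Memoryless {S A : Type} (σ : Sched S A) : Prop :=
  ∀ π π' : FinPath S A, π.last = π'.last → σ π = σ π'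

/-- Deterministic schedulers choose Dirac distributions. -/
def Deterministic {S A : Type} (σ : Sched S A) : Prop := ∀ π a, σ π a = 0 ∨ σ π a = 1

/-- Deterministic memoryless (DM) schedulers. -/
def DM {S A : Type} (σ : Sched S A) : Prop := Memoryless σ ∧ Deterministic σ

namespace MDP

variable {S A : Type} [Fintype S] [Fintype A]

/-- Probability of visiting `T` within `n` steps (terminal states made absorbing),
starting from the history `π`, under the scheduler `σ`. -/
noncomputable def reachN (M : MDP S A) (σ : Sched S A) (T : Set S) :
    ℕ → FinPath S A → ℝ
  | 0, π => if π.last ∈ T then 1 else 0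
  | n + 1, π =>
      if π.last ∈ T then 1
      else ∑ a : A, σ π a * ∑ s' : S, M.prob π.last a s' * reachN M σ T n (π.snoc a s')

/-- `Pr^{M,σ}(s ⊨ ◇T)`: the probability, under the measure on infinite paths induced
by `σ` from `s` (terminal states made absorbing), of the paths that visit `T`; it is
the supremum of the bounded-horizon reachability probabilities. -/
noncomputable def Pr (M : MDP S A) (σ : Sched S A) (s : S) (T : Set S) : ℝ :=
  ⨆ n : ℕ, M.reachN σ T n ⟨s, []⟩

end MDP

/-- An open MDP: an MDP together with (totally ordered, given as lists) sets of
rightward/leftward entrances and exits. -/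
structure OMDP (S A : Type) : Type where
  M : MDP S A
  Ir : List S
  Il : List S
  Or : List S
  Ol : List S

namespace OMDP

variable {S A : Type}

/-- The entrances `I = I_r ∪ I_l`. -/
def entr (𝒜 : OMDP S A) : List S := 𝒜.Ir ++ 𝒜.Il

/-- The exits `O = O_r ∪ O_l`. -/
def exit (𝒜 : OMDP S A) : List S := 𝒜.Or ++ 𝒜.Ol

/-- The index type of exits. -/
abbrev ExitIdx (𝒜 : OMDP S A) : Type := {s : S // s ∈ 𝒜.exit}

/-- The index type of entrances. -/
abbrev EntrIdx (𝒜 : OMDP S A) : Type := {s : S // s ∈ 𝒜.entr}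

variable [Fintype S] [Fintype A]

/-- Well-formedness of an open MDP: the transitions are probability
distributions, the open ends are pairwise disjoint (each without duplicates),
and the exits are exactly the terminal states. -/
def WF (𝒜 : OMDP S A) : Prop :=
  𝒜.M.Proper ∧ (𝒜.Ir ++ 𝒜.Il ++ 𝒜.Or ++ 𝒜.Ol).Nodup ∧
    ∀ s : S, s ∈ 𝒜.exit ↔ 𝒜.M.terminal s

/-- `Pr^{𝒜,σ}(i ⊨ ◇O) ∈ ℝ^O`: the vector of reachability probabilities to each exit. -/
noncomputable def prVec (𝒜 : OMDP S A) (σ : Sched S A) (i : S) : 𝒜.ExitIdx → ℝ :=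
  fun j => 𝒜.M.Pr σ i {j.1}

/-- The set `A^𝒜(i)` of achievable points from `i`. -/
def achievable (𝒜 : OMDP S A) (i : S) : Set (𝒜.ExitIdx → ℝ) :=
  {p | ∃ σ : Sched S A, 𝒜.M.IsSched σ ∧ p ≤ 𝒜.prVec σ i}

/-- The set `A^{𝒜,Σ}(i)` of points achievable from `i` by schedulers in the class `C`. -/
def achievableBy (𝒜 : OMDP S A) (i : S) (C : Sched S A → Prop) : Set (𝒜.ExitIdx → ℝ) :=
  {p | ∃ σ : Sched S A, 𝒜.M.IsSched σ ∧ C σ ∧ p ≤ 𝒜.prVec σ i}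

/-- The Pareto curve `𝒮(𝒜, i)`: achievable points not strictly dominated by an
achievable point. -/
def pareto (𝒜 : OMDP S A) (i : S) : Set (𝒜.ExitIdx → ℝ) :=
  {p | p ∈ 𝒜.achievable i ∧ ∀ q ∈ 𝒜.achievable i, p ≤ q → q = p}

end OMDP

/-- Downward closure. -/
def dw {ι : Type} (X : Set (ι → ℝ)) : Set (ι → ℝ) := {p | ∃ q ∈ X, p ≤ q}

/-- Downward convex closure. -/
def dwConv {ι : Type} (X : Set (ι → ℝ)) : Set (ι → ℝ) := dw (convexHull ℝ X)

/-- Subdistributions on `ι`: nonnegative points with coordinate sum at most 1. -/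
def Subdist {ι : Type} [Fintype ι] (p : ι → ℝ) : Prop :=
  (∀ j, 0 ≤ p j) ∧ ∑ j, p j ≤ 1

end SD

namespace SD

namespace OMDP

variable {S₁ A₁ S₂ A₂ : Type}

/-- The sequential composition `𝒜 ⨟ ℬ` of type-matching open MDPs: the disjoint
union of the two oMDPs in which the `i`-th rightward exit of `𝒜` moves with
probability 1 to the `i`-th rightward entrance of `ℬ` and the `i`-th leftward
exit of `ℬ` moves with probability 1 to the `i`-th leftward entrance of `𝒜`;
its entrances are `(I_r^𝒜, I_l^ℬ)` and its exits are `(O_r^ℬ, O_l^𝒜)`. -/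
noncomputable def seqComp (𝒜 : OMDP S₁ A₁) (ℬ : OMDP S₂ A₂)
    (h₁ : 𝒜.Or.length = ℬ.Ir.length) (h₂ : ℬ.Ol.length = 𝒜.Il.length) :
    OMDP (S₁ ⊕ S₂) (A₁ ⊕ A₂) where
  M := ⟨fun t a =>
    match t with
    | Sum.inl s =>
        if h : ∃ k : Fin 𝒜.Or.length, 𝒜.Or.get k = s then
          some fun t' => if t' = Sum.inr (ℬ.Ir.get (Fin.cast h₁ h.choose)) then 1 else 0
        else
          match a with
          | Sum.inl a => (𝒜.M.P s a).map fun d => Sum.elim d fun _ => 0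
          | Sum.inr _ => none
    | Sum.inr s =>
        if h : ∃ k : Fin ℬ.Ol.length, ℬ.Ol.get k = s then
          some fun t' => if t' = Sum.inl (𝒜.Il.get (Fin.cast h₂ h.choose)) then 1 else 0
        else
          match a with
          | Sum.inr a => (ℬ.M.P s a).map fun d => Sum.elim (fun _ => 0) d
          | Sum.inl _ => none⟩
  Ir := 𝒜.Ir.map Sum.inl
  Il := ℬ.Il.map Sum.inr
  Or := ℬ.Or.map Sum.inr
  Ol := 𝒜.Ol.map Sum.inl

/-- The sequential composition `σ₁ ⨟ σ₂` of memoryless schedulers on `𝒜` and `ℬ`: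
it behaves like `σ₁` on the states of `𝒜` and like `σ₂` on the states of `ℬ`
(on the connecting exits, where all actions induce the same probability-1
transition, it plays uniformly). -/
noncomputable def schedSeqComp [Fintype A₁] [Fintype A₂] (𝒜 : OMDP S₁ A₁) (ℬ : OMDP S₂ A₂)
    (σ₁ : Sched S₁ A₁) (σ₂ : Sched S₂ A₂) : Sched (S₁ ⊕ S₂) (A₁ ⊕ A₂) := fun π a =>
  match π.last, a with
  | Sum.inl s, a =>
      if s ∈ 𝒜.Or then ((Fintype.card (A₁ ⊕ A₂) : ℝ))⁻¹
      else
        match a with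
        | Sum.inl a => σ₁ ⟨s, []⟩ a
        | Sum.inr _ => 0
  | Sum.inr s, a =>
      if s ∈ ℬ.Ol then ((Fintype.card (A₁ ⊕ A₂) : ℝ))⁻¹
      else
        match a with
        | Sum.inr a => σ₂ ⟨s, []⟩ a
        | Sum.inl _ => 0

/-- The restriction of a (memoryless) scheduler on `𝒜 ⨟ ℬ` to the states of `𝒜`. -/
noncomputable def restrictL [Fintype S₁] [Fintype A₁] (𝒜 : OMDP S₁ A₁)
    (τ : Sched (S₁ ⊕ S₂) (A₁ ⊕ A₂)) : Sched S₁ A₁ := fun π a =>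
  if 𝒜.M.terminal π.last then 0 else τ ⟨Sum.inl π.last, []⟩ (Sum.inl a)

/-- The restriction of a (memoryless) scheduler on `𝒜 ⨟ ℬ` to the states of `ℬ`. -/
noncomputable def restrictR [Fintype S₂] [Fintype A₂] (ℬ : OMDP S₂ A₂)
    (τ : Sched (S₁ ⊕ S₂) (A₁ ⊕ A₂)) : Sched S₂ A₂ := fun π a =>
  if ℬ.M.terminal π.last then 0 else τ ⟨Sum.inr π.last, []⟩ (Sum.inr a)

end OMDP

end SD

namespace SD

section Hitting

variable {S : Type} [Fintype S]

/-- Nonnegative matrices with row sums at most one. -/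
def Substochastic (Q : S → S → ℝ) : Prop :=
  ∀ s, (∀ s', 0 ≤ Q s s') ∧ ∑ s', Q s s' ≤ 1

/-- Probability of hitting `T` within `n` steps of the chain with transition matrix `Q`. -/
noncomputable def hitN (Q : S → S → ℝ) (T : Set S) : ℕ → S → ℝ
  | 0, s => if s ∈ T then 1 else 0
  | n + 1, s => if s ∈ T then 1 else ∑ s', Q s s' * hitN Q T n s'

/-- Probability of eventually hitting `T` in the chain with transition matrix `Q`. -/
noncomputable def hit (Q : S → S → ℝ) (T : Set S) (s : S) : ℝ := ⨆ n, hitN Q T n s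

variable {Q : S → S → ℝ} {T : Set S} {s : S}

theorem hitN_of_mem (hs : s ∈ T) (n : ℕ) : hitN Q T n s = 1 := by
  cases n <;> simp [hitN, hs]

theorem hitN_succ_of_notMem (hs : s ∉ T) (n : ℕ) :
    hitN Q T (n + 1) s = ∑ s', Q s s' * hitN Q T n s' := by
  simp [hitN, hs]

theorem hit_of_mem (hs : s ∈ T) : hit Q T s = 1 := by
  simp [hit, hitN_of_mem hs]

theorem hitN_of_notMem_of_row_zero (hs : s ∉ T) (h : ∀ s', Q s s' = 0) (n : ℕ) :
    hitN Q T n s = 0 := by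
  cases n <;> simp [hitN, hs, h]

theorem hit_of_notMem_of_row_zero (hs : s ∉ T) (h : ∀ s', Q s s' = 0) : hit Q T s = 0 := by
  simp [hit, hitN_of_notMem_of_row_zero hs h]

theorem hitN_nonneg (hQ : Substochastic Q) (n : ℕ) (s : S) : 0 ≤ hitN Q T n s := by
  induction n generalizing s with
  | zero => simp only [hitN]; split_ifs <;> norm_num
  | succ n ih =>
    simp only [hitN]
    split_ifs
    · norm_num
    · exact Finset.sum_nonneg fun s' _ => mul_nonneg ((hQ s).1 s') (ih s')

theorem hitN_le_one (hQ : Substochastic Q) (n : ℕ) (s : S) : hitN Q T n s ≤ 1 := by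
  induction n generalizing s with
  | zero => simp only [hitN]; split_ifs <;> norm_num
  | succ n ih =>
    simp only [hitN]
    split_ifs
    · norm_num
    · exact (Finset.sum_le_sum fun s' _ => mul_le_of_le_one_right ((hQ s).1 s') (ih s')).trans
        (hQ s).2

theorem hitN_le_succ (hQ : Substochastic Q) (n : ℕ) (s : S) :
    hitN Q T n s ≤ hitN Q T (n + 1) s := by
  by_cases hs : s ∈ T
  · simp [hitN_of_mem hs]
  induction n generalizing s with
  | zero => simpa [hitN, hs] using hitN_nonneg (T := T) hQ 1 s
  | succ n ih =>
    rw [hitN_succ_of_notMem hs, hitN_succ_of_notMem hs]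
    refine Finset.sum_le_sum fun s' _ => mul_le_mul_of_nonneg_left ?_ ((hQ s).1 s')
    by_cases hs' : s' ∈ T
    · simp [hitN_of_mem hs']
    · exact ih s' hs'

theorem hitN_bddAbove (hQ : Substochastic Q) (T : Set S) (s : S) :
    BddAbove (Set.range fun n => hitN Q T n s) :=
  ⟨1, by rintro _ ⟨n, rfl⟩; exact hitN_le_one hQ n s⟩

theorem hitN_le_hit (hQ : Substochastic Q) (n : ℕ) (s : S) : hitN Q T n s ≤ hit Q T s :=
  le_ciSup (hitN_bddAbove hQ T s) n

theorem hit_nonneg (hQ : Substochastic Q) (s : S) : 0 ≤ hit Q T s :=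
  (hitN_nonneg hQ 0 s).trans (hitN_le_hit hQ 0 s)

theorem tendsto_hitN (hQ : Substochastic Q) (T : Set S) (s : S) :
    Filter.Tendsto (fun n => hitN Q T n s) Filter.atTop (nhds (hit Q T s)) :=
  tendsto_atTop_ciSup (monotone_nat_of_le_succ fun n => hitN_le_succ hQ n s)
    (hitN_bddAbove hQ T s)

theorem hit_of_notMem (hQ : Substochastic Q) (hs : s ∉ T) :
    hit Q T s = ∑ s', Q s s' * hit Q T s' := by
  refine tendsto_nhds_unique ((Filter.tendsto_add_atTop_iff_nat 1).2 (tendsto_hitN hQ T s)) ?_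
  simp only [hitN_succ_of_notMem hs]
  exact tendsto_finsetSum _ fun s' _ => (tendsto_hitN hQ T s').const_mul _

/-- A chain `P` embedded in a chain `Q` that can only be left through the states `e k`, each of
which moves to `nx k` with probability one: a run of `Q` from the embedded part hits `T` either
inside that part, or after leaving it. -/
theorem hit_eq_hit_add_sum {C ι : Type} [Fintype C] [Fintype ι] {P : S → S → ℝ}
    {Q : C → C → ℝ} (hP : Substochastic P) (hQ : Substochastic Q) (f : S → C) {e : ι → S}
    (he : Function.Injective e) (nx : ι → C)
    (h_inner : ∀ s, s ∉ Set.range e → ∀ g : C → ℝ,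
      ∑ c, Q (f s) c * g c = ∑ s', P s s' * g (f s'))
    (h_exit : ∀ k, ∀ g : C → ℝ, ∑ c, Q (f (e k)) c * g c = g (nx k))
    (h_stop : ∀ k s', P (e k) s' = 0) {T : Set C}
    (hT : ∀ s, f s ∈ T → s ∉ Set.range e ∧ ∀ s', P s s' = 0) (s : S) :
    hit Q T (f s) = hit P (f ⁻¹' T) s + ∑ k, hit P {e k} s * hit Q T (nx k) := by
  have he_notMem : ∀ k, e k ∉ f ⁻¹' T := fun k hk => (hT _ hk).1 ⟨k, rfl⟩
  have hit_e : ∀ k k', hit P {e k'} (e k) = if k' = k then 1 else 0 := by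
    intro k k'
    split_ifs with h
    · exact hit_of_mem (by simp [h])
    · exact hit_of_notMem_of_row_zero (T := {e k'}) (fun h' => h (he h').symm) (h_stop k)
  have hitN_e : ∀ n k k', hitN P {e k'} n (e k) = if k' = k then 1 else 0 := by
    intro n k k'
    split_ifs with h
    · exact hitN_of_mem (by simp [h]) n
    · exact hitN_of_notMem_of_row_zero (T := {e k'}) (fun h' => h (he h').symm) (h_stop k) n
  apply le_antisymm
  · refine ciSup_le fun n => ?_
    have rhs_nonneg : ∀ s, 0 ≤ ∑ k, hit P {e k} s * hit Q T (nx k) := fun s =>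
      Finset.sum_nonneg fun k _ => mul_nonneg (hit_nonneg hP s) (hit_nonneg hQ _)
    induction n generalizing s with
    | zero =>
      by_cases hs : f s ∈ T
      · rw [hitN_of_mem hs, hit_of_mem (show s ∈ f ⁻¹' T from hs)]
        linarith [rhs_nonneg s]
      · simpa [hitN, hs] using add_nonneg (hit_nonneg hP s) (rhs_nonneg s)
    | succ n ih =>
      by_cases hs : f s ∈ T
      · rw [hitN_of_mem hs, hit_of_mem (show s ∈ f ⁻¹' T from hs)]
        linarith [rhs_nonneg s]
      rw [hitN_succ_of_notMem hs]
      by_cases hse : s ∈ Set.range e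
      · obtain ⟨k, rfl⟩ := hse
        rw [h_exit, hit_of_notMem_of_row_zero (he_notMem k) (h_stop k)]
        simpa [hit_e] using hitN_le_hit hQ n (nx k)
      · have hsk : ∀ k, s ∉ ({e k} : Set S) := fun k hk => hse ⟨k, hk.symm⟩
        rw [h_inner s hse, hit_of_notMem hP (show s ∉ f ⁻¹' T from hs)]
        refine (Finset.sum_le_sum fun s' _ =>
          mul_le_mul_of_nonneg_left (ih s') ((hP s).1 s')).trans_eq ?_
        simp only [fun k => hit_of_notMem hP (hsk k), mul_add, Finset.sum_add_distrib,
          Finset.sum_mul, Finset.mul_sum]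
        rw [Finset.sum_comm (s := Finset.univ (α := ι))]
        simp only [mul_assoc]
  · refine le_of_tendsto' ((tendsto_hitN hP (f ⁻¹' T) s).add (tendsto_finsetSum _ fun k _ =>
      (tendsto_hitN hP {e k} s).mul_const (hit Q T (nx k)))) fun n => ?_
    have exit_le : ∀ n k, hitN P (f ⁻¹' T) n (e k) +
        ∑ k', hitN P {e k'} n (e k) * hit Q T (nx k') ≤ hit Q T (f (e k)) := by
      intro n k
      rw [hitN_of_notMem_of_row_zero (he_notMem k) (h_stop k), hit_of_notMem hQ (show f (e k) ∉ T from he_notMem k),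
        h_exit]
      simp [hitN_e]
    have target_le : ∀ n s, f s ∈ T → hitN P (f ⁻¹' T) n s +
        ∑ k, hitN P {e k} n s * hit Q T (nx k) ≤ hit Q T (f s) := by
      intro n s hs
      have hsk : ∀ k, s ∉ ({e k} : Set S) := fun k hk => (hT s hs).1 ⟨k, hk.symm⟩
      rw [hitN_of_mem (show s ∈ f ⁻¹' T from hs), hit_of_mem hs]
      simp [fun k => hitN_of_notMem_of_row_zero (hsk k) (hT s hs).2]
    induction n generalizing s with
    | zero =>
      by_cases hs : f s ∈ T
      · exact target_le 0 s hs
      by_cases hse : s ∈ Set.range e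
      · obtain ⟨k, rfl⟩ := hse
        exact exit_le 0 k
      · have hsk : ∀ k, s ≠ e k := fun k hk => hse ⟨k, hk.symm⟩
        simpa [hitN, hs, hsk] using hit_nonneg hQ (f s)
    | succ n ih =>
      by_cases hs : f s ∈ T
      · exact target_le _ s hs
      by_cases hse : s ∈ Set.range e
      · obtain ⟨k, rfl⟩ := hse
        exact exit_le _ k
      · have hsk : ∀ k, s ∉ ({e k} : Set S) := fun k hk => hse ⟨k, hk.symm⟩
        rw [hit_of_notMem hQ hs, h_inner s hse,
          hitN_succ_of_notMem (show s ∉ f ⁻¹' T from hs)]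
        refine le_trans (le_of_eq ?_) (Finset.sum_le_sum fun s' _ =>
          mul_le_mul_of_nonneg_left (ih s') ((hP s).1 s'))
        simp only [fun k => hitN_succ_of_notMem (Q := P) (hsk k), mul_add,
          Finset.sum_add_distrib, Finset.sum_mul, Finset.mul_sum]
        rw [Finset.sum_comm (s := Finset.univ (α := ι))]
        simp only [mul_assoc]

end Hitting

@[simp]
theorem FinPath.last_nil {S A : Type} (s : S) : (⟨s, []⟩ : FinPath S A).last = s := rfl

@[simp]
theorem FinPath.last_snoc {S A : Type} (π : FinPath S A) (a : A) (s : S) :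
    (π.snoc a s).last = s := by
  simp [FinPath.last, FinPath.snoc]

namespace MDP

variable {S A : Type}

/-- The Markov chain induced by a memoryless scheduler. -/
noncomputable def chain [Fintype A] (M : MDP S A) (σ : Sched S A) (s s' : S) : ℝ :=
  ∑ a, σ ⟨s, []⟩ a * M.prob s a s'

theorem sum_chain_mul [Fintype S] [Fintype A] (M : MDP S A) (σ : Sched S A) (s : S) (g : S → ℝ) :
    ∑ s', M.chain σ s s' * g s' = ∑ a, σ ⟨s, []⟩ a * ∑ s', M.prob s a s' * g s' := by
  simp only [chain, Finset.sum_mul, Finset.mul_sum, mul_assoc]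
  exact Finset.sum_comm

theorem chain_of_terminal [Fintype A] {M : MDP S A} {s : S} (hs : M.terminal s) (σ : Sched S A) (s' : S) :
    M.chain σ s s' = 0 := by
  simp [chain, prob, hs _]

theorem Proper.prob_nonneg [Fintype S] {M : MDP S A} (hM : M.Proper) (s : S) (a : A) (s' : S) :
    0 ≤ M.prob s a s' := by
  unfold prob
  rcases h : M.P s a with _ | d
  · simp
  · exact (hM s a d h).1 s'

theorem Proper.sum_prob_le_one [Fintype S] {M : MDP S A} (hM : M.Proper) (s : S) (a : A) :
    ∑ s', M.prob s a s' ≤ 1 := by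
  unfold prob
  rcases h : M.P s a with _ | d
  · simp
  · exact (hM s a d h).2.le

theorem IsSched.sum_le_one [Fintype A] {M : MDP S A} {σ : Sched S A} (hσ : M.IsSched σ) (s : S) :
    ∑ a, σ ⟨s, []⟩ a ≤ 1 := by
  obtain ⟨-, h, h'⟩ := hσ ⟨s, []⟩ trivial
  by_cases hs : M.terminal s
  · have : ∀ a, σ ⟨s, []⟩ a = 0 := fun a => by_contra fun ha => h a ha (hs a)
    simp [this]
  · exact (h' hs).le

theorem substochastic_chain [Fintype S] [Fintype A] {M : MDP S A} (hM : M.Proper)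
    {σ : Sched S A} (hσ : M.IsSched σ) :
    Substochastic (M.chain σ) := by
  intro s
  have h := (hσ ⟨s, []⟩ trivial).1
  refine ⟨fun s' => Finset.sum_nonneg fun a _ => mul_nonneg (h a) (hM.prob_nonneg s a s'), ?_⟩
  have := M.sum_chain_mul σ s fun _ => 1
  simp only [mul_one] at this
  rw [this]
  exact (Finset.sum_le_sum fun a _ =>
    mul_le_of_le_one_right (h a) (hM.sum_prob_le_one s a)).trans (hσ.sum_le_one s)

theorem reachN_eq_hitN [Fintype S] [Fintype A] (M : MDP S A) {σ : Sched S A}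
    (hσ : Memoryless σ) (T : Set S) (n : ℕ) (π : FinPath S A) : M.reachN σ T n π = hitN (M.chain σ) T n π.last := by
  induction n generalizing π with
  | zero => rfl
  | succ n ih =>
    simp only [reachN, hitN, ih, FinPath.last_snoc, sum_chain_mul]
    rw [hσ π ⟨π.last, []⟩ rfl]

theorem Pr_eq_hit [Fintype S] [Fintype A] (M : MDP S A) {σ : Sched S A} (hσ : Memoryless σ)
    (s : S) (T : Set S) :
    M.Pr σ s T = hit (M.chain σ) T s := by
  simp only [Pr, hit, M.reachN_eq_hitN hσ, FinPath.last_nil]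

/-- The restriction of a memoryless scheduler along embeddings of states and actions. -/
noncomputable def restrict {C D : Type} (M : MDP S A) (f : S → C) (u : A → D)
    (τ : Sched C D) : Sched S A := fun π a =>
  if M.terminal π.last then 0 else τ ⟨f π.last, []⟩ (u a)

theorem memoryless_restrict {C D : Type} (M : MDP S A) (f : S → C) (u : A → D)
    (τ : Sched C D) : Memoryless (M.restrict f u τ) := by
  intro π π' h
  unfold restrict
  rw [h]

/-- Decomposition of reachability probabilities in an MDP `N` with an embedded MDP `M`
whose terminal states `e k` are connected to the states `nx k` of `N`. -/
theorem Pr_eq_Pr_restrict_add_sum [Fintype S] [Fintype A] {C D ι : Type} [Fintype C]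
    [Fintype D] [Fintype ι] {M : MDP S A} {N : MDP C D} (hM : M.Proper) (hN : N.Proper) {τ : Sched C D}
    (hτ : N.IsSched τ) (hτm : Memoryless τ) (f : S → C) {u : A → D}
    (hu : Function.Injective u) {e : ι → S} (he : Function.Injective e) (nx : ι → C)
    (h_term : ∀ k, M.terminal (e k))
    (h_inner : ∀ s, s ∉ Set.range e → ∀ a, ∀ g : C → ℝ,
      ∑ c, N.prob (f s) (u a) c * g c = ∑ s', M.prob s a s' * g (f s'))
    (h_enabled : ∀ s, s ∉ Set.range e → ∀ a, N.enabled (f s) (u a) ↔ M.enabled s a)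
    (h_outer : ∀ s, s ∉ Set.range e → ∀ d, d ∉ Set.range u → ¬N.enabled (f s) d)
    (h_exit : ∀ k d c, N.prob (f (e k)) d c = if c = nx k then 1 else 0)
    (h_live : ∀ k, ¬N.terminal (f (e k))) {T : Set C}
    (hT : ∀ s, f s ∈ T → s ∉ Set.range e ∧ M.terminal s) (s : S) :
    N.Pr τ (f s) T = M.Pr (M.restrict f u τ) s (f ⁻¹' T) +
      ∑ k, M.Pr (M.restrict f u τ) s {e k} * N.Pr τ (nx k) T := by
  have zero_of_outer : ∀ s, s ∉ Set.range e → ∀ d, d ∉ Set.range u → τ ⟨f s, []⟩ d = 0 :=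
    fun s hs d hd => by_contra fun h =>
      h_outer s hs d hd ((hτ ⟨f s, []⟩ trivial).2.1 d h)
  have hσ : M.IsSched (M.restrict f u τ) := by
    intro π _
    by_cases hπ : M.terminal π.last
    · simp [restrict, hπ]
    have hπe : π.last ∉ Set.range e := by
      rintro ⟨k, hk⟩
      exact hπ (hk ▸ h_term k)
    obtain ⟨h1, h2, h3⟩ := hτ ⟨f π.last, []⟩ trivial
    simp only [restrict, hπ, if_false]
    refine ⟨fun a => h1 _, fun a ha => (h_enabled _ hπe a).1 (h2 _ ha), fun _ => ?_⟩
    rw [Fintype.sum_of_injective u hu _ (τ ⟨f π.last, []⟩)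
      (fun d hd => zero_of_outer _ hπe d hd) fun _ => rfl]
    refine h3 fun hterm => ?_
    obtain ⟨a, ha⟩ := not_forall.1 hπ
    exact (h_enabled _ hπe a).2 ha (hterm _)
  simp only [N.Pr_eq_hit hτm, M.Pr_eq_hit (M.memoryless_restrict f u τ)]
  refine hit_eq_hit_add_sum (substochastic_chain hM hσ) (substochastic_chain hN hτ) f he nx
    (fun s hs g => ?_) (fun k g => ?_) (fun k => chain_of_terminal (h_term k) _)
    (fun s hs => ⟨(hT s hs).1, chain_of_terminal (hT s hs).2 _⟩) s
  · rw [sum_chain_mul, sum_chain_mul]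
    refine (Fintype.sum_of_injective u hu _ _ (fun d hd => ?_) fun a => ?_).symm
    · rw [zero_of_outer s hs d hd, zero_mul]
    · rw [h_inner s hs a g]
      by_cases hst : M.terminal s
      · simp [prob, hst a]
      · simp [restrict, hst]
  · rw [sum_chain_mul]
    simp only [h_exit, ite_mul, one_mul, zero_mul, Finset.sum_ite_eq', Finset.mem_univ, if_true]
    rw [← Finset.sum_mul, (hτ ⟨f (e k), []⟩ trivial).2.2 (h_live k), one_mul]

end MDP

namespace OMDP

variable {S₁ A₁ S₂ A₂ : Type} {𝒜 : OMDP S₁ A₁} {ℬ : OMDP S₂ A₂}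
  {h₁ : 𝒜.Or.length = ℬ.Ir.length} {h₂ : ℬ.Ol.length = 𝒜.Il.length}

theorem seqComp_inl_get (hnd : 𝒜.Or.Nodup) (k : Fin 𝒜.Or.length) (d : A₁ ⊕ A₂) :
    (𝒜.seqComp ℬ h₁ h₂).M.P (Sum.inl (𝒜.Or.get k)) d =
      some fun c => if c = Sum.inr (ℬ.Ir.get (Fin.cast h₁ k)) then 1 else 0 := by
  have h : ∃ k', 𝒜.Or.get k' = 𝒜.Or.get k := ⟨k, rfl⟩
  simp only [seqComp]
  rw [dif_pos h, List.nodup_iff_injective_get.1 hnd h.choose_spec]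

theorem seqComp_inr_get (hnd : ℬ.Ol.Nodup) (k : Fin ℬ.Ol.length) (d : A₁ ⊕ A₂) :
    (𝒜.seqComp ℬ h₁ h₂).M.P (Sum.inr (ℬ.Ol.get k)) d =
      some fun c => if c = Sum.inl (𝒜.Il.get (Fin.cast h₂ k)) then 1 else 0 := by
  have h : ∃ k', ℬ.Ol.get k' = ℬ.Ol.get k := ⟨k, rfl⟩
  simp only [seqComp]
  rw [dif_pos h, List.nodup_iff_injective_get.1 hnd h.choose_spec]

theorem seqComp_inl_inl {s : S₁} (hs : s ∉ Set.range 𝒜.Or.get) (a : A₁) :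
    (𝒜.seqComp ℬ h₁ h₂).M.P (Sum.inl s) (Sum.inl a) =
      (𝒜.M.P s a).map fun d => Sum.elim d fun _ => 0 := by
  simp only [seqComp]
  exact dif_neg hs

theorem seqComp_inl_inr {s : S₁} (hs : s ∉ Set.range 𝒜.Or.get) (a : A₂) :
    (𝒜.seqComp ℬ h₁ h₂).M.P (Sum.inl s) (Sum.inr a) = none := by
  simp only [seqComp]
  exact dif_neg hs

theorem seqComp_inr_inr {s : S₂} (hs : s ∉ Set.range ℬ.Ol.get) (a : A₂) :
    (𝒜.seqComp ℬ h₁ h₂).M.P (Sum.inr s) (Sum.inr a) =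
      (ℬ.M.P s a).map fun d => Sum.elim (fun _ => 0) d := by
  simp only [seqComp]
  exact dif_neg hs

theorem seqComp_inr_inl {s : S₂} (hs : s ∉ Set.range ℬ.Ol.get) (a : A₁) :
    (𝒜.seqComp ℬ h₁ h₂).M.P (Sum.inr s) (Sum.inl a) = none := by
  simp only [seqComp]
  exact dif_neg hs

theorem WF.nodup_Or [Fintype S₁] (h : 𝒜.WF) : 𝒜.Or.Nodup :=
  (List.nodup_append.1 (List.nodup_append.1 h.2.1).1).2.1

theorem WF.nodup_Ol [Fintype S₁] (h : 𝒜.WF) : 𝒜.Ol.Nodup := (List.nodup_append.1 h.2.1).2.1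

theorem WF.notMem_Or_of_mem_Ol [Fintype S₁] (h : 𝒜.WF) {s : S₁} (hs : s ∈ 𝒜.Ol) :
    s ∉ 𝒜.Or := fun hs' =>
  (List.nodup_append.1 h.2.1).2.2 s (by simp [hs']) s hs rfl

theorem WF.nonempty_of_mem_entr [Fintype S₁] (h : 𝒜.WF) {i : S₁} (hi : i ∈ 𝒜.entr) :
    Nonempty A₁ := by
  by_contra hA
  have hexit : i ∈ 𝒜.exit := (h.2.2 i).2 fun a => (hA ⟨a⟩).elim
  have hnd := h.2.1
  rw [List.append_assoc] at hnd
  exact (List.nodup_append.1 hnd).2.2 i hi i hexit rfl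

theorem WF.proper_seqComp [Fintype S₁] [Fintype S₂] (hA : 𝒜.WF) (hB : ℬ.WF) :
    (𝒜.seqComp ℬ h₁ h₂).M.Proper := by
  intro s a d hd
  rcases s with s | s
  · by_cases hs : s ∈ Set.range 𝒜.Or.get
    · obtain ⟨k, rfl⟩ := hs
      rw [seqComp_inl_get hA.nodup_Or, Option.some_inj] at hd
      subst hd
      exact ⟨fun _ => by dsimp only; split_ifs <;> norm_num, by simp⟩
    · rcases a with a | a
      · rw [seqComp_inl_inl hs, Option.map_eq_some_iff] at hd
        obtain ⟨d, hd, rfl⟩ := hd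
        obtain ⟨h1, h2⟩ := hA.1 s a d hd
        exact ⟨by rintro (x | x) <;> simp [h1], by simpa using h2⟩
      · simp [seqComp_inl_inr hs] at hd
  · by_cases hs : s ∈ Set.range ℬ.Ol.get
    · obtain ⟨k, rfl⟩ := hs
      rw [seqComp_inr_get hB.nodup_Ol, Option.some_inj] at hd
      subst hd
      exact ⟨fun _ => by dsimp only; split_ifs <;> norm_num, by simp⟩
    · rcases a with a | a
      · simp [seqComp_inr_inl hs] at hd
      · rw [seqComp_inr_inr hs, Option.map_eq_some_iff] at hd
        obtain ⟨d, hd, rfl⟩ := hd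
        obtain ⟨h1, h2⟩ := hB.1 s a d hd
        exact ⟨by rintro (x | x) <;> simp [h1], by simpa using h2⟩

end OMDP

/-- Reaching the empty set has probability zero. -/
theorem MDP.Pr_empty {S A : Type} [Fintype S] [Fintype A] (M : MDP S A) {σ : Sched S A}
    (s : S) : M.Pr σ s ∅ = 0 := by
  have h : ∀ n π, M.reachN σ ∅ n π = 0 := by
    intro n
    induction n with
    | zero => simp [MDP.reachN]
    | succ n ih => simp [MDP.reachN, ih]
  simp [MDP.Pr, h]

end SD

open SD in
/-- Let `𝒜`, `ℬ` be open MDPs such that `𝒜 ⨟ ℬ` is well-defined,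
and let `τ` be a memoryless scheduler on `𝒜 ⨟ ℬ` with restrictions `τ^𝒜`, `τ^ℬ`
to the states of `𝒜` and `ℬ`. Then for every entrance `i` of `𝒜` (resp. of `ℬ`)
and every exit `j` of `𝒜 ⨟ ℬ`:
`Pr^{𝒜⨟ℬ,τ}(i ⊨ ◇j) = Pr^{𝒜,τ^𝒜}(i ⊨ ◇j) + Σ_{k∈O_r^𝒜} Pr^{𝒜,τ^𝒜}(i ⊨ ◇k) · Pr^{𝒜⨟ℬ,τ}(Nx(k) ⊨ ◇j)`
(resp. the symmetric equation for `ℬ`), where `Pr^{𝒜,τ^𝒜}(i ⊨ ◇j) := 0` when `j`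
is not an exit of `𝒜`, and `Nx` maps the `k`-th element of `O_r^𝒜` to the `k`-th
element of `I_r^ℬ` and the `k`-th element of `O_l^ℬ` to the `k`-th element of
`I_l^𝒜`. -/
theorem statement_11 {S₁ A₁ S₂ A₂ : Type}
    [Fintype S₁] [Fintype A₁] [Fintype S₂] [Fintype A₂]
    (𝒜 : OMDP S₁ A₁) (ℬ : OMDP S₂ A₂) (hWFA : 𝒜.WF) (hWFB : ℬ.WF)
    (h₁ : 𝒜.Or.length = ℬ.Ir.length) (h₂ : ℬ.Ol.length = 𝒜.Il.length)
    (τ : Sched (S₁ ⊕ S₂) (A₁ ⊕ A₂))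
    (hτ : (𝒜.seqComp ℬ h₁ h₂).M.IsSched τ) (hτm : Memoryless τ) :
    (∀ i ∈ 𝒜.entr, ∀ j : (𝒜.seqComp ℬ h₁ h₂).ExitIdx,
      (𝒜.seqComp ℬ h₁ h₂).M.Pr τ (Sum.inl i) {j.1} =
        Sum.elim (fun s => 𝒜.M.Pr (OMDP.restrictL 𝒜 τ) i {s}) (fun _ => (0 : ℝ)) j.1 +
          ∑ k : Fin 𝒜.Or.length,
            𝒜.M.Pr (OMDP.restrictL 𝒜 τ) i {𝒜.Or.get k} *
              (𝒜.seqComp ℬ h₁ h₂).M.Pr τ (Sum.inr (ℬ.Ir.get (Fin.cast h₁ k))) {j.1}) ∧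
    (∀ i ∈ ℬ.entr, ∀ j : (𝒜.seqComp ℬ h₁ h₂).ExitIdx,
      (𝒜.seqComp ℬ h₁ h₂).M.Pr τ (Sum.inr i) {j.1} =
        Sum.elim (fun _ => (0 : ℝ)) (fun s => ℬ.M.Pr (OMDP.restrictR ℬ τ) i {s}) j.1 +
          ∑ k : Fin ℬ.Ol.length,
            ℬ.M.Pr (OMDP.restrictR ℬ τ) i {ℬ.Ol.get k} *
              (𝒜.seqComp ℬ h₁ h₂).M.Pr τ (Sum.inl (𝒜.Il.get (Fin.cast h₂ k))) {j.1}) := by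
  have hC : (𝒜.seqComp ℬ h₁ h₂).M.Proper := hWFA.proper_seqComp hWFB
  refine ⟨fun i hi j => ?_, fun i hi j => ?_⟩
  · obtain ⟨a₀⟩ := hWFA.nonempty_of_mem_entr hi
    have key := MDP.Pr_eq_Pr_restrict_add_sum hWFA.1 hC hτ hτm Sum.inl
      (u := Sum.inl) Sum.inl_injective (List.nodup_iff_injective_get.1 hWFA.nodup_Or)
      (fun k => Sum.inr (ℬ.Ir.get (Fin.cast h₁ k)))
      (fun k => (hWFA.2.2 _).1 (List.mem_append_left _ (List.get_mem _ _)))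
      (fun s hs a g => by
        rcases h : 𝒜.M.P s a with _ | d <;>
          simp [MDP.prob, OMDP.seqComp_inl_inl hs, h])
      (fun s hs a => by simp [MDP.enabled, OMDP.seqComp_inl_inl hs])
      (fun s hs d hd => by
        rcases d with d | d
        · exact (hd ⟨d, rfl⟩).elim
        · simp [MDP.enabled, OMDP.seqComp_inl_inr hs])
      (fun k d c => by
        simp only [MDP.prob, OMDP.seqComp_inl_get hWFA.nodup_Or, Option.elim_some]
        congr)
      (fun k h =>
        Option.some_ne_none _ ((OMDP.seqComp_inl_get hWFA.nodup_Or k _).symm.trans (h (Sum.inl a₀))))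
      (T := {j.1}) (fun s hs => by
        have hmem : s ∈ 𝒜.Ol := by
          have := j.2
          rw [← Set.mem_singleton_iff.1 hs] at this
          simpa [OMDP.exit, OMDP.seqComp] using this
        refine ⟨?_, (hWFA.2.2 s).1 (List.mem_append_right _ hmem)⟩
        rintro ⟨k, rfl⟩
        exact hWFA.notMem_Or_of_mem_Ol hmem (List.get_mem _ _)) i
    refine key.trans (congrArg₂ _ ?_ rfl)
    rcases hj : j.1 with s | s
    · have : (Sum.inl : S₁ → S₁ ⊕ S₂) ⁻¹' {Sum.inl s} = {s} := by ext; simp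
      rw [this]
      rfl
    · have : (Sum.inl : S₁ → S₁ ⊕ S₂) ⁻¹' {Sum.inr s} = ∅ := by ext; simp
      rw [this, MDP.Pr_empty]
      rfl
  · obtain ⟨a₀⟩ := hWFB.nonempty_of_mem_entr hi
    have key := MDP.Pr_eq_Pr_restrict_add_sum hWFB.1 hC hτ hτm Sum.inr
      (u := Sum.inr) Sum.inr_injective (List.nodup_iff_injective_get.1 hWFB.nodup_Ol)
      (fun k => Sum.inl (𝒜.Il.get (Fin.cast h₂ k)))
      (fun k => (hWFB.2.2 _).1 (List.mem_append_right _ (List.get_mem _ _)))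
      (fun s hs a g => by
        rcases h : ℬ.M.P s a with _ | d <;>
          simp [MDP.prob, OMDP.seqComp_inr_inr hs, h])
      (fun s hs a => by simp [MDP.enabled, OMDP.seqComp_inr_inr hs])
      (fun s hs d hd => by
        rcases d with d | d
        · simp [MDP.enabled, OMDP.seqComp_inr_inl hs]
        · exact (hd ⟨d, rfl⟩).elim)
      (fun k d c => by
        simp only [MDP.prob, OMDP.seqComp_inr_get hWFB.nodup_Ol, Option.elim_some]
        congr)
      (fun k h =>
        Option.some_ne_none _ ((OMDP.seqComp_inr_get hWFB.nodup_Ol k _).symm.trans (h (Sum.inr a₀))))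
      (T := {j.1}) (fun s hs => by
        have hmem : s ∈ ℬ.Or := by
          have := j.2
          rw [← Set.mem_singleton_iff.1 hs] at this
          simpa [OMDP.exit, OMDP.seqComp] using this
        refine ⟨?_, (hWFB.2.2 s).1 (List.mem_append_left _ hmem)⟩
        rintro ⟨k, rfl⟩
        exact hWFB.notMem_Or_of_mem_Ol (List.get_mem _ _) hmem) i
    refine key.trans (congrArg₂ _ ?_ rfl)
    rcases hj : j.1 with s | s
    · have : (Sum.inr : S₂ → S₁ ⊕ S₂) ⁻¹' {Sum.inl s} = ∅ := by ext; simp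
      rw [this, MDP.Pr_empty]
      rfl
    · have : (Sum.inr : S₂ → S₁ ⊕ S₂) ⁻¹' {Sum.inr s} = {s} := by ext; simp
      rw [this]
      rfl
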